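/- Let a, b be natural numbers with b > a ≥ 1, set q = b/a, and let ε > 0. Set C = a(a+b)ε^{2b+1} · (∫₀¹ (s^a − s^b)² ds)^{−1} > 0. Then there exists a function f defined near 0 with f(δ) = O(δ) as δ → 0⁺, such that for all sufficiently small δ > 0, choosing ρ = (C·δ³·(1+f(δ)))^{1/(2b+1)}, the plane curve ω_{ρ,δ} = κ_ρ * γ|_{[ρ,ε]} * σ_δ is a competitor for γ_ε: it runs from (0,0) to (ε^q, ε) and satisfies ∫ ω₂'(t)·P(ω(t))² dt = 0 over its whole parameter interval; equivalently, its horizontal lift is a horizontal curve in ℝ³ joining (0,0,0) to (ε^q, ε, 0). -/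

import Mathlib

open MeasureTheory Set Filter Asymptotics

/-- The clockwise parameterization of the boundary of the rectangle
`E_δ = [ε^q, ε^q(1+δ)] × [ε(1−δ), ε]`, starting and ending at `(ε^q, ε)`. -/
noncomputable def sigmaCurve (q ε δ : ℝ) (t : ℝ) : ℝ × ℝ :=
  if t ≤ ε ^ q * δ then (ε ^ q + t, ε)
  else if t ≤ (ε + ε ^ q) * δ then (ε ^ q * (1 + δ), ε + ε ^ q * δ - t)
  else if t ≤ (ε + 2 * ε ^ q) * δ then (ε ^ q + (ε + 2 * ε ^ q) * δ - t, ε * (1 - δ))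
  else (ε ^ q, ε - 2 * (ε + ε ^ q) * δ + t)

/-- The (a.e.) derivative of the second component of `sigmaCurve`. -/
noncomputable def dsigmaCurve2 (q ε δ : ℝ) (t : ℝ) : ℝ :=
  if t ≤ ε ^ q * δ then 0
  else if t ≤ (ε + ε ^ q) * δ then -1
  else if t ≤ (ε + 2 * ε ^ q) * δ then 0
  else 1

/-- The competing plane curve `ω_{ρ,δ} = κ_ρ * γ|_{[ρ,ε]} * σ_δ`: the cutting segment
`κ_ρ(t) = (t·ρ^{q−1}, t)` on `[0,ρ]`, the arc `γ(t) = (t^q, t)` on `[ρ,ε]`, then the clockwise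
boundary of the rectangle `E_δ`, on the interval `[0, ε + 2(ε+ε^q)δ]`. -/
noncomputable def omegaCurve (q ε ρ δ : ℝ) (t : ℝ) : ℝ × ℝ :=
  if t ≤ ρ then (t * ρ ^ (q - 1), t)
  else if t ≤ ε then (t ^ q, t)
  else sigmaCurve q ε δ (t - ε)

/-- The (a.e.) derivative of the second component of `omegaCurve`. -/
noncomputable def domegaCurve2 (q ε ρ δ : ℝ) (t : ℝ) : ℝ :=
  if t ≤ ε then 1 else dsigmaCurve2 q ε δ (t - ε)

/-- First-order expansion of `(1 + x) ^ n` with continuous remainder. -/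
lemma exists_continuous_one_add_pow_eq_linear (n : ℕ) :
    ∃ r : ℝ → ℝ, Continuous r ∧ ∀ x, (1 + x) ^ n = 1 + n * x + x ^ 2 * r x := by
  induction n with
  | zero => exact ⟨fun _ => 0, by fun_prop, fun x => by simp⟩
  | succ n ih =>
    obtain ⟨r, hr, h⟩ := ih
    refine ⟨fun x => n + (1 + x) * r x, by fun_prop, fun x => ?_⟩
    rw [pow_succ, h]
    push_cast
    ring

/-- Second-order expansion of `(1 + x) ^ n` with continuous remainder. -/
lemma exists_continuous_one_add_pow_eq_quadratic (n : ℕ) :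
    ∃ s : ℝ → ℝ, Continuous s ∧
      ∀ x, (1 + x) ^ n = 1 + n * x + n * (n - 1) / 2 * x ^ 2 + x ^ 3 * s x := by
  induction n with
  | zero => exact ⟨fun _ => 0, by fun_prop, fun x => by simp⟩
  | succ n ih =>
    obtain ⟨s, hs, h⟩ := ih
    refine ⟨fun x => n * (n - 1) / 2 + (1 + x) * s x, by fun_prop, fun x => ?_⟩
    rw [pow_succ, h]
    push_cast
    ring

/-- The normalized contribution of the rectangle boundary is
`a * (a + b) * δ ^ 3 * (1 + f δ)` with `f δ = O(δ)`. -/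
lemma exists_rectangle_expansion (a b : ℕ) (ha : 1 ≤ a) :
    ∃ h : ℝ → ℝ, Continuous h ∧ ∀ δ : ℝ,
      ((1 + δ) ^ a - 1) *
          (((1 + δ) ^ a + 1) * δ - 2 * (1 - (1 - δ) ^ (b + 1)) / (b + 1)) =
        (a : ℝ) * (a + b) * δ ^ 3 * (1 + δ * h δ) := by
  obtain ⟨r, hr, hr'⟩ := exists_continuous_one_add_pow_eq_linear a
  obtain ⟨s, hs, hs'⟩ := exists_continuous_one_add_pow_eq_quadratic (b + 1)
  have ha0 : (a : ℝ) ≠ 0 := by positivity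
  have hab0 : (a : ℝ) + b ≠ 0 := by positivity
  have hb0 : (b : ℝ) + 1 ≠ 0 := by positivity
  refine ⟨fun δ => ((a + b) * r δ + (a + δ * r δ) * (r δ - 2 * s (-δ) / (b + 1))) /
    (a * (a + b)), by fun_prop, fun δ => ?_⟩
  have h2 := hs' (-δ)
  rw [← sub_eq_add_neg] at h2
  rw [h2, hr' δ]
  push_cast
  field_simp
  ring

/-- The integral of a function agreeing with a continuous one on `Ioc c d`. -/
lemma intervalIntegrable_and_integral_eq_of_eqOn_Ioc {F g : ℝ → ℝ} {c d : ℝ} (hcd : c ≤ d)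
    (hg : Continuous g) (h : ∀ t, c < t → t ≤ d → F t = g t) :
    IntervalIntegrable F volume c d ∧ ∫ t in c..d, F t = ∫ t in c..d, g t := by
  constructor
  · refine (hg.intervalIntegrable c d).congr fun t ht => ?_
    rw [uIoc_of_le hcd] at ht
    exact (h t ht.1 ht.2).symm
  · rw [intervalIntegral.integral_of_le hcd, intervalIntegral.integral_of_le hcd]
    exact setIntegral_congr_fun measurableSet_Ioc fun t ht => h t ht.1 ht.2

lemma integral_pow_sub_pow_sq_pos {a b : ℕ} (hab : a < b) :
    0 < ∫ s in (0:ℝ)..1, (s ^ a - s ^ b) ^ 2 := by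
  refine intervalIntegral.intervalIntegral_pos_of_pos_on
    (Continuous.intervalIntegrable (by fun_prop) _ _) (fun s hs => ?_) one_pos
  have := pow_lt_pow_right_of_lt_one₀ hs.1 hs.2 hab
  have : 0 < s ^ a - s ^ b := by linarith
  positivity

/-- The contribution of the cutting segment. -/
lemma integral_cut {a b : ℕ} (hab : a < b) (ρ : ℝ) :
    ∫ t in (0:ℝ)..ρ, (t ^ a * ρ ^ (b - a) - t ^ b) ^ 2 =
      ρ ^ (2 * b + 1) * ∫ s in (0:ℝ)..1, (s ^ a - s ^ b) ^ 2 := by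
  have h := intervalIntegral.mul_integral_comp_mul_left (a := 0) (b := 1)
    (f := fun t : ℝ => (t ^ a * ρ ^ (b - a) - t ^ b) ^ 2) (c := ρ)
  simp only [mul_zero, mul_one] at h
  rw [← h, pow_succ', mul_assoc, ← intervalIntegral.integral_const_mul (ρ ^ (2 * b))]
  congr 1
  refine intervalIntegral.integral_congr fun s _ => ?_
  have e : ρ ^ b = ρ ^ a * ρ ^ (b - a) := by rw [← pow_add]; congr 1; omega
  simp only [mul_pow, pow_mul']
  rw [e]
  ring

/-- The contribution of the two vertical sides of the rectangle. -/
lemma integral_vertical_sides (b : ℕ) (m ε δ : ℝ) :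
    (∫ y in ε * (1 - δ)..ε, (ε ^ b - y ^ b) ^ 2) -
        ∫ y in ε * (1 - δ)..ε, (ε ^ b * m - y ^ b) ^ 2 =
      -(ε ^ (2 * b + 1) *
        ((m - 1) * ((m + 1) * δ - 2 * (1 - (1 - δ) ^ (b + 1)) / (b + 1)))) := by
  rw [← intervalIntegral.integral_sub (Continuous.intervalIntegrable (by fun_prop) _ _)
    (Continuous.intervalIntegrable (by fun_prop) _ _)]
  have : ∀ y : ℝ, (ε ^ b - y ^ b) ^ 2 - (ε ^ b * m - y ^ b) ^ 2 =
      (ε ^ b) ^ 2 * (1 - m ^ 2) + 2 * ε ^ b * (m - 1) * y ^ b := fun y => by ring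
  simp only [this]
  rw [intervalIntegral.integral_add intervalIntegrable_const
      (Continuous.intervalIntegrable (by fun_prop) _ _),
    intervalIntegral.integral_const, intervalIntegral.integral_const_mul, integral_pow]
  have hb0 : (b : ℝ) + 1 ≠ 0 := by positivity
  simp only [smul_eq_mul, mul_pow, pow_succ, pow_mul']
  field_simp
  ring

/-- The line integral of `P ^ 2 dx₂` along `omegaCurve`. -/
lemma integral_omegaCurve {a b : ℕ} (ha : 1 ≤ a) (hab : a < b) {ε ρ δ : ℝ}
    (hδ : 0 < δ) (hρ : 0 < ρ) (hρε : ρ ≤ ε) {q : ℝ} (hq : q = (b : ℝ) / a) :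
    (∫ t in (0:ℝ)..(ε + 2 * (ε + ε ^ q) * δ), domegaCurve2 q ε ρ δ t *
        ((omegaCurve q ε ρ δ t).1 ^ a - (omegaCurve q ε ρ δ t).2 ^ b) ^ 2) =
      (ρ ^ (2 * b + 1) * ∫ s in (0:ℝ)..1, (s ^ a - s ^ b) ^ 2) -
        ε ^ (2 * b + 1) * (((1 + δ) ^ a - 1) *
          (((1 + δ) ^ a + 1) * δ - 2 * (1 - (1 - δ) ^ (b + 1)) / (b + 1))) := by
  have ha0 : (a : ℝ) ≠ 0 := by positivity
  have hε : 0 < ε := hρ.trans_le hρε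
  have he : 0 < ε ^ q := Real.rpow_pos_of_pos hε q
  have hpow : ∀ t : ℝ, 0 ≤ t → (t ^ q) ^ a = t ^ b := fun t ht => by
    rw [← Real.rpow_mul_natCast ht, hq, div_mul_cancel₀ _ ha0, Real.rpow_natCast]
  have hcut : (ρ ^ (q - 1)) ^ a = ρ ^ (b - a) := by
    rw [← Real.rpow_mul_natCast hρ.le, hq, sub_mul, div_mul_cancel₀ _ ha0, one_mul,
      ← Nat.cast_sub hab.le, Real.rpow_natCast]
  have hee := hpow ε hε.le
  have p1 : 0 < ε * δ := by positivity
  have p2 : 0 < ε ^ q * δ := by positivity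
  set F : ℝ → ℝ := fun t => domegaCurve2 q ε ρ δ t *
    ((omegaCurve q ε ρ δ t).1 ^ a - (omegaCurve q ε ρ δ t).2 ^ b) ^ 2 with hF
  obtain ⟨i1, e1⟩ := intervalIntegrable_and_integral_eq_of_eqOn_Ioc (F := F)
    (g := fun t => (t ^ a * ρ ^ (b - a) - t ^ b) ^ 2) hρ.le (by fun_prop) fun t ht ht' => by
      simp only [hF, domegaCurve2, omegaCurve]
      rw [if_pos (ht'.trans hρε), if_pos ht', mul_pow, hcut, one_mul]
  obtain ⟨i2, e2⟩ := intervalIntegrable_and_integral_eq_of_eqOn_Ioc (F := F)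
    (g := fun _ => 0) hρε (by fun_prop) fun t ht ht' => by
      simp only [hF, domegaCurve2, omegaCurve]
      rw [if_pos ht', if_neg ht.not_ge, if_pos ht']
      simp [hpow t (hρ.trans ht).le]
  obtain ⟨i3, e3⟩ := intervalIntegrable_and_integral_eq_of_eqOn_Ioc (F := F)
    (c := ε) (d := ε + ε ^ q * δ) (g := fun _ => 0) (by linarith) (by fun_prop)
    fun t ht ht' => by
      simp only [hF, domegaCurve2, dsigmaCurve2]
      rw [if_neg ht.not_ge, if_pos (by linarith), zero_mul]
  obtain ⟨i4, e4⟩ := intervalIntegrable_and_integral_eq_of_eqOn_Ioc (F := F)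
    (c := ε + ε ^ q * δ) (d := ε + (ε + ε ^ q) * δ)
    (g := fun t => -(ε ^ b * (1 + δ) ^ a - (2 * ε + ε ^ q * δ - t) ^ b) ^ 2)
    (by linarith) (by fun_prop) fun t ht ht' => by
      simp only [hF, domegaCurve2, omegaCurve, dsigmaCurve2, sigmaCurve]
      rw [if_neg (by linarith), if_neg (by linarith), if_pos (by linarith),
        if_neg (by linarith), if_neg (by linarith), if_neg (by linarith),
        if_pos (by linarith), mul_pow, hee]
      ring
  obtain ⟨i5, e5⟩ := intervalIntegrable_and_integral_eq_of_eqOn_Ioc (F := F)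
    (c := ε + (ε + ε ^ q) * δ) (d := ε + (ε + 2 * ε ^ q) * δ) (g := fun _ => 0)
    (by linarith) (by fun_prop) fun t ht ht' => by
      simp only [hF, domegaCurve2, dsigmaCurve2]
      rw [if_neg (by linarith), if_neg (by linarith), if_neg (by linarith),
        if_pos (by linarith), zero_mul]
  obtain ⟨i6, e6⟩ := intervalIntegrable_and_integral_eq_of_eqOn_Ioc (F := F)
    (c := ε + (ε + 2 * ε ^ q) * δ) (d := ε + 2 * (ε + ε ^ q) * δ)
    (g := fun t => (ε ^ b - (t - 2 * (ε + ε ^ q) * δ) ^ b) ^ 2)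
    (by linarith) (by fun_prop) fun t ht ht' => by
      simp only [hF, domegaCurve2, omegaCurve, dsigmaCurve2, sigmaCurve]
      rw [if_neg (by linarith), if_neg (by linarith), if_neg (by linarith),
        if_neg (by linarith), if_neg (by linarith), if_neg (by linarith),
        if_neg (by linarith), if_neg (by linarith), if_neg (by linarith), hee]
      ring_nf
  have right_side := intervalIntegral.integral_comp_sub_left (a := ε + ε ^ q * δ)
    (b := ε + (ε + ε ^ q) * δ) (fun y : ℝ => (ε ^ b * (1 + δ) ^ a - y ^ b) ^ 2)
    (2 * ε + ε ^ q * δ)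
  have left_side := intervalIntegral.integral_comp_sub_right (a := ε + (ε + 2 * ε ^ q) * δ)
    (b := ε + 2 * (ε + ε ^ q) * δ) (fun y : ℝ => (ε ^ b - y ^ b) ^ 2)
    (2 * (ε + ε ^ q) * δ)
  rw [show 2 * ε + ε ^ q * δ - (ε + (ε + ε ^ q) * δ) = ε * (1 - δ) by ring,
    show 2 * ε + ε ^ q * δ - (ε + ε ^ q * δ) = ε by ring] at right_side
  rw [show ε + (ε + 2 * ε ^ q) * δ - 2 * (ε + ε ^ q) * δ = ε * (1 - δ) by ring,
    show ε + 2 * (ε + ε ^ q) * δ - 2 * (ε + ε ^ q) * δ = ε by ring] at left_side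
  have sides := integral_vertical_sides b ((1 + δ) ^ a) ε δ
  rw [integral_cut hab] at e1
  rw [intervalIntegral.integral_neg, right_side] at e4
  rw [left_side] at e6
  simp only [intervalIntegral.integral_zero] at e2 e3 e5
  rw [← intervalIntegral.integral_add_adjacent_intervals
      ((((i1.trans i2).trans i3).trans i4).trans i5) i6,
    ← intervalIntegral.integral_add_adjacent_intervals (((i1.trans i2).trans i3).trans i4) i5,
    ← intervalIntegral.integral_add_adjacent_intervals ((i1.trans i2).trans i3) i4,
    ← intervalIntegral.integral_add_adjacent_intervals (i1.trans i2) i3,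
    ← intervalIntegral.integral_add_adjacent_intervals i1 i2]
  linarith

/-- Lemma 3.6 of the paper. With
`C = a(a+b)ε^{2b+1}·(∫₀¹(s^a−s^b)² ds)⁻¹ > 0`, there is a function `f(δ) = O(δ)` as `δ → 0⁺`
such that for all sufficiently small `δ > 0`, choosing `ρ = (Cδ³(1+f(δ)))^{1/(2b+1)}`, the plane
curve `ω_{ρ,δ}` is a competitor for `γ_ε`: it runs from `(0,0)` to `(ε^q, ε)` and the third
coordinate of its horizontal lift vanishes at the final time. -/
theorem competitor_exists (a b : ℕ) (ha : 1 ≤ a) (hab : a < b)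
    (q : ℝ) (hq : q = (b : ℝ) / a) (ε : ℝ) (hε : 0 < ε) (C : ℝ)
    (hC : C = (a : ℝ) * (a + b) * ε ^ (2 * b + 1) /
        ∫ s in (0:ℝ)..1, (s ^ a - s ^ b) ^ 2) :
    0 < C ∧
    ∃ f : ℝ → ℝ, f =O[nhdsWithin 0 (Ioi 0)] (fun δ => δ) ∧
      ∃ δ₀ : ℝ, 0 < δ₀ ∧ ∀ δ : ℝ, 0 < δ → δ < δ₀ →
        ∀ ρ : ℝ, ρ = (C * δ ^ 3 * (1 + f δ)) ^ ((2 * (b : ℝ) + 1)⁻¹) →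
          omegaCurve q ε ρ δ 0 = (0, 0) ∧
          omegaCurve q ε ρ δ (ε + 2 * (ε + ε ^ q) * δ) = (ε ^ q, ε) ∧
          (∫ t in (0:ℝ)..(ε + 2 * (ε + ε ^ q) * δ),
              domegaCurve2 q ε ρ δ t *
                ((omegaCurve q ε ρ δ t).1 ^ a - (omegaCurve q ε ρ δ t).2 ^ b) ^ 2) = 0 := by
  have hJ := integral_pow_sub_pow_sq_pos hab
  have ha0 : (0 : ℝ) < a := by exact_mod_cast ha
  have hCpos : 0 < C := by rw [hC]; positivity
  refine ⟨hCpos, ?_⟩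
  obtain ⟨h, hcont, hexp⟩ := exists_rectangle_expansion a b ha
  refine ⟨fun δ => δ * h δ, ?_, ?_⟩
  · have hbd : h =O[nhdsWithin 0 (Ioi 0)] (fun _ => (1 : ℝ)) :=
      (hcont.tendsto 0).isBigO_one ℝ |>.mono nhdsWithin_le_nhds
    simpa using (isBigO_refl (fun δ : ℝ => δ) _).mul hbd
  have hpos : ∀ᶠ δ : ℝ in nhds 0, 0 < 1 + δ * h δ :=
    Continuous.tendsto' (by fun_prop) 0 1 (by simp) |>.eventually_const_lt one_pos
  have hsmall : ∀ᶠ δ : ℝ in nhds 0, C * δ ^ 3 * (1 + δ * h δ) < ε ^ (2 * b + 1) :=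
    Continuous.tendsto' (by fun_prop) 0 0 (by simp) |>.eventually_lt_const (by positivity)
  obtain ⟨δ₀, hδ₀, hball⟩ := Metric.eventually_nhds_iff.1 (hpos.and hsmall)
  refine ⟨δ₀, hδ₀, fun δ hδ hδ' ρ hρ => ?_⟩
  obtain ⟨h1, h2⟩ := hball (y := δ) (by simpa [abs_of_pos hδ] using hδ')
  have hbase : 0 < C * δ ^ 3 * (1 + δ * h δ) := by positivity
  have hρ0 : 0 < ρ := hρ ▸ Real.rpow_pos_of_pos hbase _
  have hρpow : ρ ^ (2 * b + 1) = C * δ ^ 3 * (1 + δ * h δ) := by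
    have := Real.rpow_inv_natCast_pow hbase.le (n := 2 * b + 1) (by omega)
    push_cast at this
    rw [hρ, this]
  have hρε : ρ < ε := lt_of_pow_lt_pow_left₀ (2 * b + 1) hε.le (hρpow ▸ h2)
  have he : 0 < ε ^ q := Real.rpow_pos_of_pos hε q
  refine ⟨by simp [omegaCurve, hρ0.le], ?_, ?_⟩
  · have p1 : 0 < ε * δ := by positivity
    have p2 : 0 < ε ^ q * δ := by positivity
    rw [omegaCurve, if_neg (by nlinarith), if_neg (by nlinarith), sigmaCurve,
      if_neg (by nlinarith), if_neg (by nlinarith), if_neg (by nlinarith)]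
    ext <;> simp
  · rw [integral_omegaCurve ha hab hδ hρ0 hρε.le hq, hρpow, hexp, hC]
    field_simp
    ring
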